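/- arXiv:2002.05289 — 2 statements merged into one kernel-verified Lean document; each statement's English description precedes it below -/
import Mathlib

section
/- Let ξ > 1 and suppose ξ Σ2 − Σ1 and ξ Σ1 − Σ2 are both positive semidefinite. Then for every δ ∈ ℝ^p, setting ζ = n1/(n1+n2), the vector v obtained by stacking (1 − ζ) X1 δ on top of −ζ X2 δ satisfies ‖v‖² ≥ ξ^{-1} · (n1 n2 / (n1+n2)²) · ‖X δ‖². -/
open Matrix

/-- Stacking a vector in `ℝ^{n1}` on top of a vector in `ℝ^{n2}`. -/
noncomputable def stack2 {n1 n2 : ℕ} (a : Fin n1 → ℝ) (b : Fin n2 → ℝ) :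
    EuclideanSpace ℝ (Fin n1 ⊕ Fin n2) := (WithLp.equiv 2 _).symm (Sum.elim a b)

lemma dotProduct_transpose_mul_self_mulVec {m p : Type*} [Fintype m] [Fintype p]
    (A : Matrix m p ℝ) (δ : p → ℝ) : δ ⬝ᵥ ((Aᵀ * A) *ᵥ δ) = ∑ i, (A *ᵥ δ) i ^ 2 := by
  rw [← mulVec_mulVec, dotProduct_mulVec, vecMul_transpose]
  simp only [dotProduct, ← pow_two]

/-- The Loewner bound `c • S - T ≥ 0` between scaled Gram matrices `S = a • AᵀA` and `T = b • BᵀB`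
bounds the quadratic form of `T` by `c` times that of `S`. -/
lemma gram_quadratic_form_le_of_posSemidef {m n p : Type*} [Fintype m] [Fintype n] [Fintype p]
    {A : Matrix m p ℝ} {B : Matrix n p ℝ} {a b c : ℝ}
    (h : (c • a • (Aᵀ * A) - b • (Bᵀ * B)).PosSemidef) (δ : p → ℝ) :
    b * ∑ i, (B *ᵥ δ) i ^ 2 ≤ c * (a * ∑ i, (A *ᵥ δ) i ^ 2) := by
  have hδ := h.dotProduct_mulVec_nonneg δ
  simp only [star_trivial, sub_mulVec, smul_mulVec, dotProduct_sub, dotProduct_smul,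
    dotProduct_transpose_mul_self_mulVec, smul_eq_mul] at hδ
  linarith

lemma norm_sq_stack2 {n1 n2 : ℕ} (a : Fin n1 → ℝ) (b : Fin n2 → ℝ) :
    ‖stack2 a b‖ ^ 2 = ∑ i, a i ^ 2 + ∑ i, b i ^ 2 := by
  simp [stack2, EuclideanSpace.norm_sq_eq]

/-- If `ξ Σ2 − Σ1` and `ξ Σ1 − Σ2` are positive semidefinite with `ξ > 1`, then the vector
`v = ((1 − ζ) X1 δ; −ζ X2 δ)` satisfies `‖v‖² ≥ ξ⁻¹ (n1 n2 / (n1+n2)²) ‖X δ‖²`. -/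
theorem norm_sq_recentered_lower_bound
    (p n1 n2 : ℕ) (hp : 0 < p) (hn1 : 0 < n1) (hn2 : 0 < n2)
    (X1 : Matrix (Fin n1) (Fin p) ℝ) (X2 : Matrix (Fin n2) (Fin p) ℝ)
    (X : Matrix (Fin n1 ⊕ Fin n2) (Fin p) ℝ) (hX : X = fromRows X1 X2)
    (Sig1 Sig2 : Matrix (Fin p) (Fin p) ℝ)
    (hSig1 : Sig1 = (n1 : ℝ)⁻¹ • (X1ᵀ * X1)) (hSig2 : Sig2 = (n2 : ℝ)⁻¹ • (X2ᵀ * X2))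
    (ξ : ℝ) (hξ : 1 < ξ)
    (hpsd1 : (ξ • Sig2 - Sig1).PosSemidef) (hpsd2 : (ξ • Sig1 - Sig2).PosSemidef) :
    ∀ δ : Fin p → ℝ, ∀ ζ : ℝ, ζ = (n1 : ℝ) / (n1 + n2) →
      ξ⁻¹ * ((n1 : ℝ) * n2 / ((n1 : ℝ) + n2) ^ 2) * ‖(WithLp.equiv 2 ((Fin n1 ⊕ Fin n2) → ℝ)).symm (X.mulVec δ)‖ ^ 2 ≤
        ‖stack2 ((1 - ζ) • X1.mulVec δ) ((-ζ) • X2.mulVec δ)‖ ^ 2 := by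
  intro δ ζ hζ
  subst hX hSig1 hSig2
  have h12 := gram_quadratic_form_le_of_posSemidef hpsd1 δ
  have h21 := gram_quadratic_form_le_of_posSemidef hpsd2 δ
  have hX : (WithLp.equiv 2 ((Fin n1 ⊕ Fin n2) → ℝ)).symm (fromRows X1 X2 *ᵥ δ) =
      stack2 (X1 *ᵥ δ) (X2 *ᵥ δ) := by
    rw [fromRows_mulVec, stack2]
  rw [hX, norm_sq_stack2, norm_sq_stack2]
  simp only [Pi.smul_apply, smul_eq_mul, mul_pow, ← Finset.mul_sum]
  set a := ∑ i, (X1 *ᵥ δ) i ^ 2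
  set b := ∑ i, (X2 *ᵥ δ) i ^ 2
  have hn1' : (0 : ℝ) < n1 := by exact_mod_cast hn1
  have hn2' : (0 : ℝ) < n2 := by exact_mod_cast hn2
  have hξ' : 0 < ξ := by linarith
  obtain ⟨s, hs⟩ : ∃ s, s = (n1 : ℝ)⁻¹ * a := ⟨_, rfl⟩
  obtain ⟨t, ht⟩ : ∃ t, t = (n2 : ℝ)⁻¹ * b := ⟨_, rfl⟩
  rw [← hs, ← ht] at h12 h21
  have ha : a = n1 * s := by rw [hs]; field_simp
  have hb : b = n2 * t := by rw [ht]; field_simp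
  have hsum : ξ⁻¹ * (n1 * s + n2 * t) ≤ n2 * s + n1 * t := by
    rw [inv_mul_le_iff₀ hξ']
    linarith [mul_le_mul_of_nonneg_left h12 hn1'.le, mul_le_mul_of_nonneg_left h21 hn2'.le]
  have hcoef : (0 : ℝ) ≤ n1 * n2 / (n1 + n2) ^ 2 := by positivity
  calc ξ⁻¹ * ((n1 : ℝ) * n2 / (n1 + n2) ^ 2) * (a + b)
      = n1 * n2 / (n1 + n2) ^ 2 * (ξ⁻¹ * (n1 * s + n2 * t)) := by rw [ha, hb]; ring
    _ ≤ n1 * n2 / (n1 + n2) ^ 2 * (n2 * s + n1 * t) := mul_le_mul_of_nonneg_left hsum hcoef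
    _ = (1 - ζ) ^ 2 * a + (-ζ) ^ 2 * b := by
      rw [ha, hb, hζ]
      field_simp
      ring
end

section
/- Let ξ ∈ (1, 2) and suppose ξ Σ2 − Σ1 and ξ Σ1 − Σ2 are both positive semidefinite. Setting ζ = n1/(n1+n2), both matrices (ξ(ξ−1)/2) · (XᵀX/(n1+n2)) − √(ζ(1−ζ)) (Σ1 − Σ2) and (ξ(ξ−1)/2) · (XᵀX/(n1+n2)) − √(ζ(1−ζ)) (Σ2 − Σ1) are positive semidefinite, where XᵀX/(n1+n2) = ζ Σ1 + (1−ζ) Σ2. -/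
open Matrix

/-- If `0 ⪯ A ⪯ ξ B` with `ξ ≥ 1`, then `√(ζ(1−ζ))(A − B) ⪯ (ξ(ξ−1)/2)(ζ A + (1−ζ) B)` for every
`ζ ∈ [0,1]`: the difference is a nonnegative combination of `ξ B − A` and `A`. -/
lemma Matrix.PosSemidef.convexCombination_sub_sqrt_smul_sub {m : Type*}
    {A B : Matrix m m ℝ} {ξ ζ : ℝ} (hA : A.PosSemidef) (hAB : (ξ • B - A).PosSemidef)
    (hξ : 1 ≤ ξ) (h0 : 0 ≤ ζ) (h1 : ζ ≤ 1) :
    ((ξ * (ξ - 1) / 2) • (ζ • A + (1 - ζ) • B) - √(ζ * (1 - ζ)) • (A - B)).PosSemidef := by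
  have hs : √(ζ * (1 - ζ)) ≤ 1 / 2 :=
    Real.sqrt_le_iff.mpr ⟨by norm_num, by nlinarith [sq_nonneg (ζ - 1 / 2)]⟩
  have hs0 := Real.sqrt_nonneg (ζ * (1 - ζ))
  set s := √(ζ * (1 - ζ))
  have hξ0 : 0 < ξ := by linarith
  have hξ' : 0 ≤ ξ - 1 := by linarith
  have hζ' : 0 ≤ 1 - ζ := by linarith
  have hα : 0 ≤ (ξ * (ξ - 1) / 2 * (1 - ζ) + s) / ξ := by positivity
  have hβ : 0 ≤ (ξ - 1) * (ξ / 2 * (ζ * (ξ - 1) + 1) - s) / ξ := by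
    have h : 0 ≤ ξ / 2 * (ζ * (ξ - 1) + 1) - s := by
      nlinarith [mul_nonneg hξ0.le (mul_nonneg h0 hξ')]
    positivity
  convert (hAB.smul hα).add (hA.smul hβ) using 1
  ext i j
  simp only [sub_apply, add_apply, smul_apply, smul_eq_mul]
  field_simp
  ring

/-- Under the Loewner comparisons `Σ1 ⪯ ξ Σ2` and `Σ2 ⪯ ξ Σ1` with `ξ ∈ (1,2)`, both
`(ξ(ξ−1)/2)·(XᵀX/(n1+n2)) − √(ζ(1−ζ))(Σ1 − Σ2)` and the version with `Σ1, Σ2` swapped are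
positive semidefinite, where `XᵀX/(n1+n2) = ζ Σ1 + (1−ζ) Σ2` and `ζ = n1/(n1+n2)`. -/
theorem gram_difference_loewner_bound
    (p n1 n2 : ℕ) (hp : 0 < p) (hn1 : 0 < n1) (hn2 : 0 < n2)
    (X1 : Matrix (Fin n1) (Fin p) ℝ) (X2 : Matrix (Fin n2) (Fin p) ℝ)
    (X : Matrix (Fin n1 ⊕ Fin n2) (Fin p) ℝ) (hX : X = fromRows X1 X2)
    (Sig1 Sig2 : Matrix (Fin p) (Fin p) ℝ)
    (hSig1 : Sig1 = (n1 : ℝ)⁻¹ • (X1ᵀ * X1)) (hSig2 : Sig2 = (n2 : ℝ)⁻¹ • (X2ᵀ * X2))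
    (ξ : ℝ) (hξ1 : 1 < ξ) (hξ2 : ξ < 2)
    (hpsd1 : (ξ • Sig2 - Sig1).PosSemidef) (hpsd2 : (ξ • Sig1 - Sig2).PosSemidef)
    (ζ : ℝ) (hζ : ζ = (n1 : ℝ) / (n1 + n2)) :
    ((n1 : ℝ) + n2)⁻¹ • (Xᵀ * X) = ζ • Sig1 + (1 - ζ) • Sig2 ∧
    ((ξ * (ξ - 1) / 2) • (((n1 : ℝ) + n2)⁻¹ • (Xᵀ * X)) -
      Real.sqrt (ζ * (1 - ζ)) • (Sig1 - Sig2)).PosSemidef ∧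
    ((ξ * (ξ - 1) / 2) • (((n1 : ℝ) + n2)⁻¹ • (Xᵀ * X)) -
      Real.sqrt (ζ * (1 - ζ)) • (Sig2 - Sig1)).PosSemidef := by
  have h1 : (0 : ℝ) < n1 := Nat.cast_pos.mpr hn1
  have h2 : (0 : ℝ) < n2 := Nat.cast_pos.mpr hn2
  have hζ0 : 0 ≤ ζ := by rw [hζ]; positivity
  have hζ1 : 1 - ζ = n2 / (n1 + n2) := by rw [hζ]; field_simp; ring
  have hζ1' : 0 ≤ 1 - ζ := by rw [hζ1]; positivity
  have hS1 : Sig1.PosSemidef := by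
    rw [hSig1]
    exact (posSemidef_conjTranspose_mul_self X1).smul (inv_nonneg.mpr h1.le)
  have hS2 : Sig2.PosSemidef := by
    rw [hSig2]
    exact (posSemidef_conjTranspose_mul_self X2).smul (inv_nonneg.mpr h2.le)
  have hgram : ((n1 : ℝ) + n2)⁻¹ • (Xᵀ * X) = ζ • Sig1 + (1 - ζ) • Sig2 := by
    rw [hζ1, hζ, hSig1, hSig2, hX, transpose_fromRows, fromCols_mul_fromRows, smul_smul,
      smul_smul, smul_add]
    congr 2 <;> field_simp
  refine ⟨hgram, ?_, ?_⟩ <;> rw [hgram]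
  · exact hS1.convexCombination_sub_sqrt_smul_sub hpsd1 hξ1.le hζ0 (by linarith)
  · have h := hS2.convexCombination_sub_sqrt_smul_sub hpsd2 hξ1.le hζ1' (by linarith)
    rwa [sub_sub_cancel, add_comm, mul_comm (1 - ζ)] at h
end
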